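/- Let N ≥ 3 be an integer, x₀ ∈ ℝ^N, i ∈ {1,…,N}, S_{x₀}(x) := 1/((N−2)ω_N |x−x₀|^{N−2}), and let Φ be a real function that is harmonic on an open ball B_d(x₀) for some d > 0. Set G := S_{x₀} − Φ (defined on B_d(x₀) \ {x₀}). Then lim_{θ→0⁺} Q_{θ,i}(G, G) = −2 (∂Φ/∂x_i)(x₀). -/

import Mathlib

open MeasureTheory Metric Real
open scoped RealInnerProductSpace ENNReal

/-- The Euclidean Laplacian `Δu = Σ_{i=1}^N ∂²u/∂x_i²` on `ℝ^N`. -/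
noncomputable def laplacian {N : ℕ} (u : EuclideanSpace ℝ (Fin N) → ℝ)
    (x : EuclideanSpace ℝ (Fin N)) : ℝ :=
  ∑ i : Fin N, fderiv ℝ (fun y => fderiv ℝ u y (EuclideanSpace.single i 1)) x
    (EuclideanSpace.single i 1)

/-- The quadratic boundary form
`P_θ(u,v) = -θ∫_{∂B_θ(x₀)} ⟨∇u,ν⟩⟨∇v,ν⟩ + (θ/2)∫ ⟨∇u,∇v⟩
  + ((2-N)/4)∫ ⟨∇u,ν⟩ v + ((2-N)/4)∫ ⟨∇v,ν⟩ u`,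
where `ν(x) = (x-x₀)/θ` and integrals are over the sphere `∂B_θ(x₀)` with respect to the
`(N-1)`-dimensional Hausdorff measure. -/
noncomputable def Pform {N : ℕ} (x₀ : EuclideanSpace ℝ (Fin N)) (θ : ℝ)
    (u v : EuclideanSpace ℝ (Fin N) → ℝ) : ℝ :=
  -θ * ∫ x in sphere x₀ θ,
      (⟪gradient u x, θ⁻¹ • (x - x₀)⟫) * (⟪gradient v x, θ⁻¹ • (x - x₀)⟫) ∂μH[(N : ℝ) - 1]
  + (θ / 2) * ∫ x in sphere x₀ θ,
      (⟪gradient u x, gradient v x⟫) ∂μH[(N : ℝ) - 1]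
  + ((2 - (N : ℝ)) / 4) * ∫ x in sphere x₀ θ,
      (⟪gradient u x, θ⁻¹ • (x - x₀)⟫) * v x ∂μH[(N : ℝ) - 1]
  + ((2 - (N : ℝ)) / 4) * ∫ x in sphere x₀ θ,
      (⟪gradient v x, θ⁻¹ • (x - x₀)⟫) * u x ∂μH[(N : ℝ) - 1]

/-- The quadratic boundary form
`Q_{θ,i}(u,v) = -∫_{∂B_θ(x₀)} ⟨∇v,ν⟩ ∂u/∂x_i - ∫ ⟨∇u,ν⟩ ∂v/∂x_i + ∫ ⟨∇u,∇v⟩ ν_i`,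
where `ν(x) = (x-x₀)/θ` and integrals are over the sphere `∂B_θ(x₀)` with respect to the
`(N-1)`-dimensional Hausdorff measure. -/
noncomputable def Qform {N : ℕ} (x₀ : EuclideanSpace ℝ (Fin N)) (θ : ℝ) (i : Fin N)
    (u v : EuclideanSpace ℝ (Fin N) → ℝ) : ℝ :=
  -(∫ x in sphere x₀ θ,
      (⟪gradient v x, θ⁻¹ • (x - x₀)⟫) * fderiv ℝ u x (EuclideanSpace.single i 1)
        ∂μH[(N : ℝ) - 1])
  - ∫ x in sphere x₀ θ,
      (⟪gradient u x, θ⁻¹ • (x - x₀)⟫) * fderiv ℝ v x (EuclideanSpace.single i 1)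
        ∂μH[(N : ℝ) - 1]
  + ∫ x in sphere x₀ θ,
      (⟪gradient u x, gradient v x⟫) * ((x - x₀) i / θ) ∂μH[(N : ℝ) - 1]

/-- The `(N-1)`-dimensional surface measure of the unit sphere in `ℝ^N`. -/
noncomputable def omegaN (N : ℕ) : ℝ :=
  (μH[(N : ℝ) - 1] (sphere (0 : EuclideanSpace ℝ (Fin N)) 1)).toReal

/-- The fundamental solution `S_{x₀}(x) = 1/((N-2) ω_N |x-x₀|^{N-2})` of `-Δ` with pole `x₀`. -/
noncomputable def fundSol {N : ℕ} (x₀ x : EuclideanSpace ℝ (Fin N)) : ℝ :=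
  1 / (((N : ℝ) - 2) * omegaN N * ‖x - x₀‖ ^ (N - 2))

/-- `W_{x₀,h}(x) = (x_h - (x₀)_h)/(ω_N |x-x₀|^N)`, the partial derivative of
`S_{x₀}(x)` with respect to the `h`-th coordinate of the pole `x₀`. -/
noncomputable def poleDeriv {N : ℕ} (x₀ : EuclideanSpace ℝ (Fin N)) (h : Fin N)
    (x : EuclideanSpace ℝ (Fin N)) : ℝ :=
  (x h - x₀ h) / (omegaN N * ‖x - x₀‖ ^ N)

section SphereMeasure

variable {E : Type*} [NormedAddCommGroup E] [InnerProductSpace ℝ E] [MeasurableSpace E]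
  [BorelSpace E] {n : ℕ}

theorem hausdorffMeasure_unitSphere_lt_top [FiniteDimensional ℝ E]
    (hE : Module.finrank ℝ E = n + 1) :
    μH[(n : ℝ)] (sphere (0 : E) 1) < ∞ := by
  have : Fact (Module.finrank ℝ E = n + 1) := ⟨hE⟩
  refine (isCompact_sphere (0 : E) 1).measure_lt_top_of_nhdsWithin fun v hv => ?_
  have hv1 : ‖v‖ = 1 := by simpa using hv
  have hv0 : v ≠ 0 := by rintro rfl; simp at hv1
  have hrank : Module.finrank ℝ (ℝ ∙ v)ᗮ = n := Submodule.finrank_orthogonal_span_singleton hv0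
  have horth : ∀ w : (ℝ ∙ v)ᗮ, ⟪v, (w : E)⟫ = 0 := fun w =>
    Submodule.mem_orthogonal_singleton_iff_inner_right.1 w.2
  set g : (ℝ ∙ v)ᗮ → E := fun w => ‖v + (w : E)‖⁻¹ • (v + (w : E)) with hg
  have hne : ∀ w : (ℝ ∙ v)ᗮ, v + (w : E) ≠ 0 := fun w h => by
    have h1 : ⟪v, v + (w : E)⟫ = 0 := by rw [h, inner_zero_right]
    rw [inner_add_right, horth, real_inner_self_eq_norm_sq, hv1] at h1
    norm_num at h1
  have hadd : ContDiff ℝ 1 fun w : (ℝ ∙ v)ᗮ => v + (w : E) :=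
    contDiff_const.add (ℝ ∙ v)ᗮ.subtypeL.contDiff
  have hsmooth : ContDiff ℝ 1 g :=
    ((hadd.norm ℝ hne).inv fun w => norm_ne_zero_iff.2 (hne w)).smul hadd
  obtain ⟨K, hK⟩ := hsmooth.locallyLipschitz.locallyLipschitzOn
    (s := closedBall (0 : (ℝ ∙ v)ᗮ) 3) |>.exists_lipschitzOnWith_of_compact
    (isCompact_closedBall _ _)
  refine ⟨g '' closedBall 0 3, ?_, ?_⟩
  · have hopen : {x : E | 1 / 2 < ⟪v, x⟫} ∈ nhds v :=
      (isOpen_lt continuous_const (by fun_prop)).mem_nhds (by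
        simp only [Set.mem_ofPred_eq, real_inner_self_eq_norm_sq, hv1]; norm_num)
    filter_upwards [mem_nhdsWithin_of_mem_nhds hopen, self_mem_nhdsWithin] with x hx hxs
    have hx1 : ‖x‖ = 1 := by simpa using hxs
    have hx2 : 1 / 2 < ⟪v, x⟫ := hx
    have hpos : 0 < ⟪v, x⟫ := by linarith
    have hmem : (⟪v, x⟫)⁻¹ • x - v ∈ (ℝ ∙ v)ᗮ := by
      rw [Submodule.mem_orthogonal_singleton_iff_inner_right, inner_sub_right, inner_smul_right,
        real_inner_self_eq_norm_sq, hv1, inv_mul_cancel₀ hpos.ne']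
      norm_num
    have hinv : (⟪v, x⟫)⁻¹ ≤ 2 := by
      rw [inv_le_comm₀ hpos two_pos]; linarith
    refine ⟨⟨_, hmem⟩, ?_, ?_⟩
    · rw [mem_closedBall_zero_iff, Submodule.coe_norm]
      refine (norm_sub_le _ _).trans ?_
      rw [norm_smul, hx1, hv1, norm_inv, Real.norm_of_nonneg hpos.le]
      linarith
    · simp only [hg, add_sub_cancel]
      rw [norm_smul, hx1, norm_inv, Real.norm_of_nonneg hpos.le, smul_smul]
      simp [hpos.ne']
  · refine (hK.hausdorffMeasure_image_le (Nat.cast_nonneg n)).trans_lt ?_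
    refine ENNReal.mul_lt_top (ENNReal.rpow_lt_top_of_nonneg (Nat.cast_nonneg n) (by simp)) ?_
    have := (isCompact_closedBall (0 : (ℝ ∙ v)ᗮ) 3).measure_lt_top
      (μ := μH[Module.finrank ℝ (ℝ ∙ v)ᗮ])
    rwa [hrank] at this

theorem hausdorffMeasure_unitSphere_pos [FiniteDimensional ℝ E]
    (hE : Module.finrank ℝ E = n + 1) :
    0 < μH[(n : ℝ)] (sphere (0 : E) 1) := by
  have : Fact (Module.finrank ℝ E = n + 1) := ⟨hE⟩
  have : Nontrivial E := Module.nontrivial_of_finrank_pos (R := ℝ) (by omega)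
  obtain ⟨v, hv1⟩ := exists_norm_eq E zero_le_one
  have hv0 : v ≠ 0 := by rintro rfl; simp at hv1
  have hrank : Module.finrank ℝ (ℝ ∙ v)ᗮ = n := Submodule.finrank_orthogonal_span_singleton hv0
  have hball : 0 < μH[(n : ℝ)] (ball (0 : (ℝ ∙ v)ᗮ) 1) := by
    have := measure_ball_pos μH[Module.finrank ℝ (ℝ ∙ v)ᗮ] (0 : (ℝ ∙ v)ᗮ) one_pos
    rwa [hrank] at this
  have hlip : LipschitzWith 1 (ℝ ∙ v)ᗮ.orthogonalProjectionOnto :=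
    (ℝ ∙ v)ᗮ.lipschitzWith_orthogonalProjectionOnto
  have hsub : ball (0 : (ℝ ∙ v)ᗮ) 1 ⊆
      (ℝ ∙ v)ᗮ.orthogonalProjectionOnto '' sphere (0 : E) 1 := by
    intro w hw
    have hw1 : ‖(w : E)‖ < 1 := by simpa using hw
    have horth : ⟪(w : E), v⟫ = 0 := Submodule.mem_orthogonal_singleton_iff_inner_left.1 w.2
    refine ⟨w + √(1 - ‖(w : E)‖ ^ 2) • v, ?_, ?_⟩
    · have hs : 0 ≤ 1 - ‖(w : E)‖ ^ 2 := by nlinarith [norm_nonneg (w : E)]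
      rw [mem_sphere_zero_iff_norm, ← sq_eq_sq₀ (norm_nonneg _) zero_le_one, sq,
        norm_add_sq_eq_norm_sq_add_norm_sq_real (by rw [inner_smul_right, horth, mul_zero]),
        norm_smul, hv1, Real.norm_of_nonneg (Real.sqrt_nonneg _), mul_one,
        Real.mul_self_sqrt hs]
      ring
    · have hv : (ℝ ∙ v)ᗮ.orthogonalProjectionOnto v = 0 := by
        rw [Submodule.orthogonalProjectionOnto_eq_zero_iff, Submodule.orthogonal_orthogonal]
        exact Submodule.mem_span_singleton_self v
      rw [map_add, map_smul, hv, smul_zero, add_zero,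
        Submodule.orthogonalProjectionOnto_mem_subspace_eq_self]
  have := (hball.trans_le (measure_mono hsub)).trans_le
    (hlip.hausdorffMeasure_image_le (Nat.cast_nonneg n) _)
  simpa using this

open scoped Pointwise in
/-- Surface measure of a sphere scales with the `n`-th power of the radius. -/
theorem hausdorffMeasure_sphere_eq (x₀ : E) {θ : ℝ} (hθ : 0 < θ) :
    μH[(n : ℝ)] (sphere x₀ θ) = ENNReal.ofReal (θ ^ n) * μH[(n : ℝ)] (sphere (0 : E) 1) := by
  have himage : IsometryEquiv.addRight x₀ '' (θ • sphere (0 : E) 1) = sphere x₀ θ := by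
    change (fun x => x + x₀) '' _ = _
    rw [smul_sphere' hθ.ne']
    ext x
    simp [Set.image_add_right, abs_of_pos hθ, sub_eq_add_neg]
  rw [← himage, IsometryEquiv.hausdorffMeasure_image,
    Measure.hausdorffMeasure_smul₀ (Nat.cast_nonneg n) hθ.ne', ENNReal.smul_def, smul_eq_mul]
  congr 1
  rw [NNReal.rpow_natCast, ENNReal.ofReal, ENNReal.coe_inj]
  ext
  simp [abs_of_pos hθ, hθ.le]

/-- An odd function with respect to the centre integrates to zero on a sphere. -/
theorem setIntegral_sphere_eq_zero_of_odd (x₀ : E) (θ r : ℝ) {f : E → ℝ}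
    (hf : ∀ x, f (Equiv.pointReflection x₀ x) = -f x) :
    ∫ x in sphere x₀ θ, f x ∂μH[r] = 0 := by
  set e : E ≃ᵢ E := (AffineIsometryEquiv.pointReflection ℝ x₀).toIsometryEquiv
  have hpre : e ⁻¹' sphere x₀ θ = sphere x₀ θ := by
    ext x
    have : dist (e x) x₀ = dist x x₀ :=
      (dist_pointReflection_left x₀ x).trans (dist_comm _ _)
    rw [Set.mem_preimage, mem_sphere, mem_sphere, this]
  have h := (e.measurePreserving_hausdorffMeasure r).setIntegral_preimage_emb
    e.toHomeomorph.measurableEmbedding f (sphere x₀ θ)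
  have hfe : ∀ x, f (e x) = -f x := hf
  simp only [hpre, hfe, integral_neg] at h
  linarith

end SphereMeasure

section SurfaceMeasure

variable {N : ℕ}

theorem hausdorffMeasure_sphere_lt_top (hN : 1 ≤ N) (x₀ : EuclideanSpace ℝ (Fin N)) {θ : ℝ}
    (hθ : 0 < θ) : μH[(N : ℝ) - 1] (sphere x₀ θ) < ∞ := by
  rw [← Nat.cast_pred hN, hausdorffMeasure_sphere_eq x₀ hθ]
  exact ENNReal.mul_lt_top ENNReal.ofReal_lt_top
    (hausdorffMeasure_unitSphere_lt_top (by rw [finrank_euclideanSpace_fin]; omega))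

theorem omegaN_pos (hN : 1 ≤ N) : 0 < omegaN N := by
  refine ENNReal.toReal_pos ?_ (hausdorffMeasure_sphere_lt_top hN 0 one_pos).ne
  rw [← Nat.cast_pred hN]
  exact (hausdorffMeasure_unitSphere_pos (by rw [finrank_euclideanSpace_fin]; omega)).ne'

theorem measureReal_sphere_eq (hN : 1 ≤ N) (x₀ : EuclideanSpace ℝ (Fin N)) {θ : ℝ}
    (hθ : 0 < θ) : (μH[(N : ℝ) - 1]).real (sphere x₀ θ) = omegaN N * θ ^ (N - 1) := by
  rw [measureReal_def, omegaN, ← Nat.cast_pred hN, hausdorffMeasure_sphere_eq x₀ hθ,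
    ENNReal.toReal_mul, ENNReal.toReal_ofReal (by positivity), mul_comm]

theorem ContinuousOn.integrableOn_sphere (hN : 1 ≤ N) {x₀ : EuclideanSpace ℝ (Fin N)} {θ : ℝ}
    (hθ : 0 < θ) {f : EuclideanSpace ℝ (Fin N) → ℝ} (hf : ContinuousOn f (sphere x₀ θ)) :
    IntegrableOn f (sphere x₀ θ) μH[(N : ℝ) - 1] := by
  obtain ⟨C, hC⟩ := (isCompact_sphere x₀ θ).exists_bound_of_continuousOn hf
  have hs : MeasurableSet (sphere x₀ θ) := isClosed_sphere.measurableSet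
  exact ⟨hf.aestronglyMeasurable hs, .restrict_of_bounded (C := C)
    (hausdorffMeasure_sphere_lt_top hN x₀ hθ) ((ae_restrict_iff' hs).2 (.of_forall hC))⟩

end SurfaceMeasure

theorem hasGradientAt_fundSol {N : ℕ} (hN : 3 ≤ N) {x₀ x : EuclideanSpace ℝ (Fin N)}
    (hx : x ≠ x₀) :
    HasGradientAt (fundSol x₀) (-(omegaN N * ‖x - x₀‖ ^ N)⁻¹ • (x - x₀)) x := by
  obtain ⟨m, rfl⟩ : ∃ m, N = m + 3 := ⟨N - 3, by omega⟩
  have hω := (omegaN_pos (N := m + 3) (by omega)).ne'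
  have hr : ‖x - x₀‖ ≠ 0 := norm_ne_zero_iff.2 (sub_ne_zero.2 hx)
  have hnorm : HasFDerivAt (fun y => ‖y - x₀‖) (‖x - x₀‖⁻¹ • innerSL ℝ (x - x₀)) x := by
    have h := (((hasFDerivAt_id x).sub_const x₀).norm_sq).sqrt (by simpa using hr)
    simp only [id, Real.sqrt_sq (norm_nonneg _)] at h
    refine h.congr_fderiv ?_
    ext y
    simp
    field_simp
  have hm : (m : ℝ) + 1 ≠ 0 := by positivity
  have hpow : HasDerivAt (fun r : ℝ => 1 / ((((m + 3 : ℕ) : ℝ) - 2) * omegaN (m + 3) * r ^ (m + 1)))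
      (-(omegaN (m + 3) * ‖x - x₀‖ ^ (m + 2))⁻¹) ‖x - x₀‖ := by
    have hm' : ((m + 3 : ℕ) : ℝ) - 2 = m + 1 := by push_cast; ring
    rw [hm']
    have h := ((hasDerivAt_pow (m + 1) ‖x - x₀‖).const_mul (((m : ℝ) + 1) * omegaN (m + 3))).inv
      (mul_ne_zero (mul_ne_zero hm hω) (pow_ne_zero _ hr))
    simp only [one_div]
    refine h.congr_deriv ?_
    push_cast
    field_simp
    ring
  rw [hasGradientAt_iff_hasFDerivAt]
  refine (hpow.comp_hasFDerivAt x hnorm).congr_fderiv ?_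
  ext y
  simp
  field_simp
  ring

/-- Expansion of the integrand of `Qform` for a field with radial part `c • ν`. -/
theorem inner_radial_expansion {E : Type*} [NormedAddCommGroup E] [InnerProductSpace ℝ E]
    (c : ℝ) (ν g e : E) (hν : ‖ν‖ = 1) :
    -(2 * (⟪c • ν + g, ν⟫ * ⟪c • ν + g, e⟫)) + ⟪c • ν + g, c • ν + g⟫ * ⟪ν, e⟫ =
      -(c ^ 2 * ⟪ν, e⟫) - 2 * c * ⟪g, e⟫ + (⟪g, g⟫ * ⟪ν, e⟫ - 2 * (⟪g, ν⟫ * ⟪g, e⟫)) := by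
  simp only [inner_add_left, inner_add_right, inner_smul_left, inner_smul_right,
    real_inner_self_eq_norm_sq ν, hν, real_inner_comm g ν, conj_trivial]
  rw [real_inner_comm ν g]
  ring

theorem abs_inner_remainder_le {E : Type*} [NormedAddCommGroup E] [InnerProductSpace ℝ E]
    {ν g e : E} (hν : ‖ν‖ = 1) (he : ‖e‖ = 1) {M : ℝ} (hg : ‖g‖ ≤ M) :
    |⟪g, g⟫ * ⟪ν, e⟫ - 2 * (⟪g, ν⟫ * ⟪g, e⟫)| ≤ 3 * M ^ 2 := by
  have h1 := abs_real_inner_le_norm g g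
  have h2 := abs_real_inner_le_norm ν e
  have h3 := abs_real_inner_le_norm g ν
  have h4 := abs_real_inner_le_norm g e
  rw [hν, he, mul_one] at h2
  rw [hν, mul_one] at h3
  rw [he, mul_one] at h4
  calc |⟪g, g⟫ * ⟪ν, e⟫ - 2 * (⟪g, ν⟫ * ⟪g, e⟫)|
      ≤ |⟪g, g⟫| * |⟪ν, e⟫| + 2 * (|⟪g, ν⟫| * |⟪g, e⟫|) := by
        refine (abs_sub _ _).trans_eq ?_
        simp only [abs_mul, abs_two]
    _ ≤ (‖g‖ * ‖g‖) * 1 + 2 * (‖g‖ * ‖g‖) := by gcongr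
    _ = 3 * ‖g‖ ^ 2 := by ring
    _ ≤ 3 * M ^ 2 := by gcongr

/-- The boundary form of a Green function, up to an additive constant `2 * p`, as one integral
in which the singular part only enters through the average of `∂Φ/∂x_i - p`. -/
theorem Qform_green_green_eq {N : ℕ} (hN : 3 ≤ N) (x₀ : EuclideanSpace ℝ (Fin N)) (i : Fin N)
    {d θ : ℝ} (hθ : 0 < θ) (hθd : θ < d) {Φ : EuclideanSpace ℝ (Fin N) → ℝ}
    (hΦ : DifferentiableOn ℝ Φ (ball x₀ d)) (hgrad : ContinuousOn (gradient Φ) (ball x₀ d))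
    (p : ℝ) :
    Qform x₀ θ i (fun x => fundSol x₀ x - Φ x) (fun x => fundSol x₀ x - Φ x) + 2 * p =
      ∫ x in sphere x₀ θ, (-(2 * (omegaN N * θ ^ (N - 1))⁻¹ *
          (⟪gradient Φ x, EuclideanSpace.single i 1⟫ - p)) +
        (⟪gradient Φ x, gradient Φ x⟫ * ⟪θ⁻¹ • (x - x₀), EuclideanSpace.single i 1⟫ -
          2 * (⟪gradient Φ x, θ⁻¹ • (x - x₀)⟫ * ⟪gradient Φ x, EuclideanSpace.single i 1⟫)))
        ∂μH[(N : ℝ) - 1] := by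
  have hN1 : 1 ≤ N := by omega
  set e : EuclideanSpace ℝ (Fin N) := EuclideanSpace.single i 1 with he
  set c : ℝ := (omegaN N * θ ^ (N - 1))⁻¹ with hc
  set ν : EuclideanSpace ℝ (Fin N) → EuclideanSpace ℝ (Fin N) := fun x => θ⁻¹ • (x - x₀) with hν
  set w : EuclideanSpace ℝ (Fin N) → EuclideanSpace ℝ (Fin N) :=
    fun x => c • ν x + gradient Φ x with hw
  have hs : MeasurableSet (sphere x₀ θ) := isClosed_sphere.measurableSet
  have hsub : sphere x₀ θ ⊆ ball x₀ d := fun x hx => by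
    rw [mem_ball, mem_sphere.1 hx]; exact hθd
  have hG : ∀ x ∈ sphere x₀ θ, HasGradientAt (fun x => fundSol x₀ x - Φ x) (-w x) x := by
    intro x hx
    have hxθ : ‖x - x₀‖ = θ := by rw [← dist_eq_norm]; exact hx
    have hS := hasGradientAt_fundSol hN (x₀ := x₀) (x := x) fun h => by
      rw [h, sub_self, norm_zero] at hxθ; exact hθ.ne hxθ
    have hP := (hΦ.differentiableAt (isOpen_ball.mem_nhds (hsub hx))).hasGradientAt
    rw [hasGradientAt_iff_hasFDerivAt] at hS hP ⊢
    refine (hS.sub hP).congr_fderiv ?_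
    rw [← map_sub]
    congr 1
    rw [hw, hxθ]
    have hNpow : θ ^ N = θ ^ (N - 1) * θ := by rw [← pow_succ, Nat.sub_add_cancel hN1]
    simp only [hν, hc, smul_smul, hNpow, mul_inv, neg_add, neg_smul, mul_assoc, sub_eq_add_neg]
  have hνc : ContinuousOn ν (sphere x₀ θ) := by fun_prop
  have hgc : ContinuousOn (gradient Φ) (sphere x₀ θ) := hgrad.mono hsub
  have hwc : ContinuousOn w (sphere x₀ θ) := (hνc.const_smul c).add hgc
  have hνn : ∀ x ∈ sphere x₀ θ, ‖ν x‖ = 1 := fun x hx => by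
    rw [hν, norm_smul, norm_inv, Real.norm_of_nonneg hθ.le, ← dist_eq_norm, mem_sphere.1 hx,
      inv_mul_cancel₀ hθ.ne']
  have hAi : IntegrableOn (fun x => ⟪w x, ν x⟫ * ⟪w x, e⟫) (sphere x₀ θ) μH[(N : ℝ) - 1] :=
    ((hwc.inner hνc).mul (hwc.inner continuousOn_const)).integrableOn_sphere hN1 hθ
  have hBi : IntegrableOn (fun x => ⟪w x, w x⟫ * ⟪ν x, e⟫) (sphere x₀ θ) μH[(N : ℝ) - 1] :=
    ((hwc.inner hwc).mul (hνc.inner continuousOn_const)).integrableOn_sphere hN1 hθ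
  have hA : ∫ x in sphere x₀ θ, ⟪gradient (fun x => fundSol x₀ x - Φ x) x, ν x⟫ *
        fderiv ℝ (fun x => fundSol x₀ x - Φ x) x e ∂μH[(N : ℝ) - 1] =
      ∫ x in sphere x₀ θ, ⟪w x, ν x⟫ * ⟪w x, e⟫ ∂μH[(N : ℝ) - 1] :=
    setIntegral_congr_fun hs fun x hx => by
      simp only [(hG x hx).gradient, (hG x hx).fderiv_apply, inner_neg_left, neg_mul_neg]
  have hB : ∫ x in sphere x₀ θ, ⟪gradient (fun x => fundSol x₀ x - Φ x) x,
        gradient (fun x => fundSol x₀ x - Φ x) x⟫ * ((x - x₀) i / θ) ∂μH[(N : ℝ) - 1] =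
      ∫ x in sphere x₀ θ, ⟪w x, w x⟫ * ⟪ν x, e⟫ ∂μH[(N : ℝ) - 1] :=
    setIntegral_congr_fun hs fun x hx => by
      have hνi : ⟪ν x, e⟫ = (x - x₀) i / θ := by
        rw [he, EuclideanSpace.inner_single_right]
        simp [hν, div_eq_inv_mul]
      simp only [(hG x hx).gradient, inner_neg_neg, hνi]
  have hodd : ∫ x in sphere x₀ θ, c ^ 2 * ⟪ν x, e⟫ ∂μH[(N : ℝ) - 1] = 0 :=
    setIntegral_sphere_eq_zero_of_odd x₀ θ _ fun x => by
      have : ν (Equiv.pointReflection x₀ x) = -ν x := by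
        simp only [hν, Equiv.pointReflection_apply, vsub_eq_sub, vadd_eq_add, add_sub_cancel_right,
          ← smul_neg, neg_sub]
      rw [this, inner_neg_left, mul_neg]
  have hoddi : IntegrableOn (fun x => c ^ 2 * ⟪ν x, e⟫) (sphere x₀ θ) μH[(N : ℝ) - 1] :=
    (continuousOn_const.mul (hνc.inner continuousOn_const)).integrableOn_sphere hN1 hθ
  have hconsti : IntegrableOn (fun _ => 2 * c * p) (sphere x₀ θ) μH[(N : ℝ) - 1] :=
    continuousOn_const.integrableOn_sphere hN1 hθ
  have hconst : ∫ _ in sphere x₀ θ, 2 * c * p ∂μH[(N : ℝ) - 1] = 2 * p := by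
    rw [setIntegral_const, measureReal_sphere_eq hN1 x₀ hθ, smul_eq_mul, hc]
    have := (omegaN_pos hN1).ne'
    field_simp
  have hsum : Qform x₀ θ i (fun x => fundSol x₀ x - Φ x) (fun x => fundSol x₀ x - Φ x) + 2 * p =
      ∫ x in sphere x₀ θ, (-(2 * (⟪w x, ν x⟫ * ⟪w x, e⟫)) + ⟪w x, w x⟫ * ⟪ν x, e⟫ +
        c ^ 2 * ⟪ν x, e⟫ + 2 * c * p) ∂μH[(N : ℝ) - 1] := by
    have hAi2 : IntegrableOn (fun x => -(2 * (⟪w x, ν x⟫ * ⟪w x, e⟫))) (sphere x₀ θ)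
      μH[(N : ℝ) - 1] := (hAi.const_mul 2).neg
    have hABi : IntegrableOn (fun x => -(2 * (⟪w x, ν x⟫ * ⟪w x, e⟫)) + ⟪w x, w x⟫ * ⟪ν x, e⟫)
      (sphere x₀ θ) μH[(N : ℝ) - 1] := hAi2.add hBi
    have hABCi : IntegrableOn (fun x => -(2 * (⟪w x, ν x⟫ * ⟪w x, e⟫)) + ⟪w x, w x⟫ * ⟪ν x, e⟫ +
      c ^ 2 * ⟪ν x, e⟫) (sphere x₀ θ) μH[(N : ℝ) - 1] := hABi.add hoddi
    rw [integral_add hABCi hconsti, integral_add hABi hoddi,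
      integral_add hAi2 hBi, integral_neg, integral_const_mul, hodd, hconst]
    unfold Qform
    rw [hA, hB]
    ring
  rw [hsum]
  refine setIntegral_congr_fun hs fun x hx => ?_
  simp only [hw]
  rw [inner_radial_expansion c (ν x) (gradient Φ x) e (hνn x hx)]
  ring

/-- If `Φ` is harmonic on a ball `B_d(x₀)` and `G = S_{x₀} - Φ`, then
`Q_{θ,i}(G, G) → -2 (∂Φ/∂x_i)(x₀)` as `θ → 0⁺`. -/
theorem Qform_green_green_limit {N : ℕ} (hN : 3 ≤ N)
    (x₀ : EuclideanSpace ℝ (Fin N)) (i : Fin N) (d : ℝ) (hd : 0 < d)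
    (Φ : EuclideanSpace ℝ (Fin N) → ℝ)
    (hΦ : ContDiffOn ℝ 2 Φ (ball x₀ d))
    (hΦ0 : ∀ x ∈ ball x₀ d, laplacian Φ x = 0) :
    Filter.Tendsto
      (fun θ : ℝ => Qform x₀ θ i (fun x => fundSol x₀ x - Φ x) (fun x => fundSol x₀ x - Φ x))
      (nhdsWithin 0 (Set.Ioi 0))
      (nhds (-2 * fderiv ℝ Φ x₀ (EuclideanSpace.single i 1))) := by
  have hN1 : 1 ≤ N := by omega
  set e : EuclideanSpace ℝ (Fin N) := EuclideanSpace.single i 1 with he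
  have hen : ‖e‖ = 1 := by simp [he]
  have hgrad : ContinuousOn (gradient Φ) (ball x₀ d) :=
    (InnerProductSpace.toDual ℝ _).symm.continuous.comp_continuousOn
      (hΦ.continuousOn_fderiv_of_isOpen isOpen_ball (by norm_num))
  have hcont : ContinuousAt (gradient Φ) x₀ := hgrad.continuousAt (ball_mem_nhds x₀ hd)
  have hωpos := omegaN_pos hN1
  have hσ : Filter.Tendsto (fun θ : ℝ => 3 * (‖gradient Φ x₀‖ + 1) ^ 2 *
      (omegaN N * θ ^ (N - 1))) (nhdsWithin 0 (Set.Ioi 0)) (nhds 0) := by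
    refine Filter.Tendsto.mono_left ?_ nhdsWithin_le_nhds
    have h : Continuous fun θ : ℝ => 3 * (‖gradient Φ x₀‖ + 1) ^ 2 *
      (omegaN N * θ ^ (N - 1)) := by fun_prop
    simpa [zero_pow (show N - 1 ≠ 0 by omega)] using h.tendsto 0
  rw [Metric.tendsto_nhds]
  intro ε hε
  obtain ⟨r, hr, hball⟩ := Metric.continuousAt_iff.1 hcont (min 1 (ε / 4)) (by positivity)
  filter_upwards [hσ.eventually_lt_const (half_pos hε), Ioo_mem_nhdsGT (lt_min hr hd)]
    with θ hθσ hθ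
  have hθ0 : 0 < θ := hθ.1
  have hσpos : 0 < omegaN N * θ ^ (N - 1) := mul_pos hωpos (pow_pos hθ0 _)
  have hnear : ∀ x ∈ sphere x₀ θ, ‖gradient Φ x - gradient Φ x₀‖ < min 1 (ε / 4) := by
    intro x hx
    rw [← dist_eq_norm]
    exact hball (by rw [mem_sphere.1 hx]; exact hθ.2.trans_le (min_le_left _ _))
  have heq := Qform_green_green_eq hN x₀ i hθ0 (hθ.2.trans_le (min_le_right _ _))
    (hΦ.differentiableOn (by norm_num)) hgrad (fderiv ℝ Φ x₀ e)
  rw [Real.dist_eq, neg_mul, sub_neg_eq_add, heq, ← Real.norm_eq_abs]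
  refine (norm_setIntegral_le_of_norm_le_const (hausdorffMeasure_sphere_lt_top hN1 x₀ hθ0)
    (C := 2 * (omegaN N * θ ^ (N - 1))⁻¹ * (ε / 4) + 3 * (‖gradient Φ x₀‖ + 1) ^ 2)
    fun x hx => ?_).trans_lt ?_
  · have hxn := hnear x hx
    refine (norm_add_le _ _).trans (add_le_add ?_ ?_)
    · rw [norm_neg, norm_mul, Real.norm_of_nonneg (by positivity), ← inner_gradient_left,
        ← inner_sub_left, Real.norm_eq_abs]
      gcongr
      refine (abs_real_inner_le_norm _ _).trans ?_
      rw [hen, mul_one]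
      exact hxn.le.trans (min_le_right _ _)
    · refine abs_inner_remainder_le ?_ hen ?_
      · rw [norm_smul, norm_inv, Real.norm_of_nonneg hθ0.le, ← dist_eq_norm, mem_sphere.1 hx,
          inv_mul_cancel₀ hθ0.ne']
      · have := norm_le_norm_add_norm_sub' (gradient Φ x) (gradient Φ x₀)
        linarith [hxn.le.trans (min_le_left _ _)]
  · rw [measureReal_sphere_eq hN1 x₀ hθ0, add_mul]
    have : 2 * (omegaN N * θ ^ (N - 1))⁻¹ * (ε / 4) * (omegaN N * θ ^ (N - 1)) = ε / 2 := by
      field_simp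
      norm_num
    linarith
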